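/- arXiv:2003.13663 — 4 statements merged into one kernel-verified Lean document; each statement's English description precedes it below -/
import Mathlib

section
/- Let Δ be a real symmetric n×n matrix all of whose eigenvalues lie in the interval [0, 2). Then for every nonzero x ∈ ℝⁿ, the vector x' = (2·I − Δ)x is nonzero and the Rayleigh quotient does not increase: R(x') ≤ R(x). -/
open Matrix

/-- A real symmetric matrix with only positive eigenvalues is positive definite. -/
theorem posDef_of_forall_hasEigenvalue_pos {n : ℕ} {P : Matrix (Fin n) (Fin n) ℝ} (hP : P.IsSymm)
    (h : ∀ μ : ℝ, Module.End.HasEigenvalue (Matrix.toLin' P) μ → 0 < μ) : P.PosDef := by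
  have hH : P.IsHermitian := by
    rw [Matrix.IsHermitian, conjTranspose_eq_transpose_of_trivial]
    exact hP
  refine hH.posDef_iff_eigenvalues_pos.2 fun i => h _ ?_
  refine Module.End.hasEigenvalue_of_hasEigenvector
    (x := WithLp.ofLp (hH.eigenvectorBasis i)) ⟨?_, ?_⟩
  · rw [Module.End.mem_eigenspace_iff, toLin'_apply]
    exact hH.mulVec_eigenvectorBasis i
  · intro h0
    exact hH.eigenvectorBasis.toBasis.ne_zero i (by
      rw [OrthonormalBasis.coe_toBasis]
      exact (WithLp.ofLp_eq_zero 2).1 h0)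

/-- Applying a positive definite matrix does not decrease its own Rayleigh quotient. -/
theorem rayleigh_mul_le_of_posDef {n : ℕ} {P : Matrix (Fin n) (Fin n) ℝ} (hP : P.PosDef)
    {x : Fin n → ℝ} (hx : x ≠ 0) :
    (x ⬝ᵥ P *ᵥ x) * (P *ᵥ x ⬝ᵥ P *ᵥ x) ≤ (P *ᵥ x ⬝ᵥ P *ᵥ (P *ᵥ x)) * (x ⬝ᵥ x) := by
  have hsymm : ∀ u v : Fin n → ℝ, u ⬝ᵥ P *ᵥ v = P *ᵥ u ⬝ᵥ v := fun u v => by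
    have ht : Pᵀ = P := by
      rw [← conjTranspose_eq_transpose_of_trivial]
      exact hP.isHermitian
    rw [dotProduct_mulVec, ← mulVec_transpose, ht]
  have h0 : 0 < x ⬝ᵥ x := by simpa using dotProduct_star_self_pos_iff.2 hx
  have h1 : 0 < x ⬝ᵥ P *ᵥ x := by simpa using hP.dotProduct_mulVec_pos hx
  set y := P *ᵥ x with hy
  have hcs : (x ⬝ᵥ y) ^ 2 ≤ (x ⬝ᵥ x) * (y ⬝ᵥ y) := by
    simpa [dotProduct, sq] using Finset.sum_mul_sq_le_sq_mul_sq Finset.univ x y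
  have hz : 0 ≤ ((x ⬝ᵥ x) • y - (x ⬝ᵥ y) • x) ⬝ᵥ P *ᵥ ((x ⬝ᵥ x) • y - (x ⬝ᵥ y) • x) := by
    simpa only [star_trivial] using
      hP.posSemidef.dotProduct_mulVec_nonneg ((x ⬝ᵥ x) • y - (x ⬝ᵥ y) • x)
  have hxy : x ⬝ᵥ P *ᵥ y = y ⬝ᵥ y := hsymm x y
  simp only [mulVec_sub, mulVec_smul, sub_dotProduct, dotProduct_sub, smul_dotProduct,
    dotProduct_smul, smul_eq_mul, hxy, ← hy] at hz
  refine le_of_mul_le_mul_left ?_ h0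
  nlinarith [mul_nonneg h1.le (sub_nonneg.2 hcs)]

/-- One-step improvement: if all eigenvalues of the symmetric matrix `Δ` lie in
`[0, 2)`, then for every nonzero `x`, the vector `x' = (2I − Δ)x` is nonzero and
the Rayleigh quotient does not increase: `R(x') ≤ R(x)`. -/
theorem stmt4 {n : ℕ} (Δ : Matrix (Fin n) (Fin n) ℝ) (hΔ : Δ.IsSymm)
    (heig : ∀ μ : ℝ, Module.End.HasEigenvalue (Matrix.toLin' Δ) μ → μ ∈ Set.Ico (0 : ℝ) 2)
    (R : (Fin n → ℝ) → ℝ)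
    (hR : ∀ x : Fin n → ℝ, R x = (x ⬝ᵥ Δ.mulVec x) / (x ⬝ᵥ x))
    (x : Fin n → ℝ) (hx : x ≠ 0) :
    ((2 : ℝ) • (1 : Matrix (Fin n) (Fin n) ℝ) - Δ).mulVec x ≠ 0 ∧
      R ((((2 : ℝ) • (1 : Matrix (Fin n) (Fin n) ℝ) - Δ)).mulVec x) ≤ R x := by
  set P := (2 : ℝ) • (1 : Matrix (Fin n) (Fin n) ℝ) - Δ with hPdef
  have hΔv : ∀ v, Δ *ᵥ v = (2 : ℝ) • v - P *ᵥ v := fun v => by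
    simp [hPdef, sub_mulVec, smul_mulVec]
  have hP : P.PosDef := by
    refine posDef_of_forall_hasEigenvalue_pos ((isSymm_one.smul 2).sub hΔ) fun μ hμ => ?_
    obtain ⟨v, hv, hv0⟩ := hμ.exists_hasEigenvector
    rw [Module.End.mem_eigenspace_iff, toLin'_apply] at hv
    have := (heig (2 - μ) (Module.End.hasEigenvalue_of_hasEigenvector (x := v) ⟨by
      rw [Module.End.mem_eigenspace_iff, toLin'_apply, hΔv, hv, sub_smul], hv0⟩)).2
    linarith
  have hy : P *ᵥ x ≠ 0 := fun h => by
    simpa [h] using hP.dotProduct_mulVec_pos hx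
  refine ⟨hy, ?_⟩
  have hx0 : 0 < x ⬝ᵥ x := by simpa using dotProduct_star_self_pos_iff.2 hx
  have hy0 : 0 < P *ᵥ x ⬝ᵥ P *ᵥ x := by simpa using dotProduct_star_self_pos_iff.2 hy
  rw [hR, hR, div_le_div_iff₀ hy0 hx0, hΔv, hΔv]
  simp only [dotProduct_sub, dotProduct_smul, smul_eq_mul]
  linarith [rayleigh_mul_le_of_posDef hP hx]
end

section
/- Let Δ be a real symmetric n×n matrix all of whose eigenvalues lie in the interval [0, 2), and let x ∈ ℝⁿ be a nonzero vector that is NOT an eigenvector of Δ. Then the Rayleigh quotient strictly decreases under the smoothing step: R((2·I − Δ)x) < R(x). -/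
open Matrix

/-- A real symmetric matrix whose eigenvalues are all less than `c` has quadratic form less than
that of `c • 1`. -/
theorem Matrix.IsSymm.dotProduct_mulVec_lt {ι : Type*} [Fintype ι] [DecidableEq ι]
    {A : Matrix ι ι ℝ} (hA : A.IsSymm) {c : ℝ}
    (heig : ∀ μ : ℝ, Module.End.HasEigenvalue (Matrix.toLin' A) μ → μ < c)
    {z : ι → ℝ} (hz : z ≠ 0) :
    z ⬝ᵥ A *ᵥ z < c * (z ⬝ᵥ z) := by
  have hB : (c • (1 : Matrix ι ι ℝ) - A).IsHermitian := by
    rw [Matrix.IsHermitian, conjTranspose_eq_transpose_of_trivial, transpose_sub, transpose_smul,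
      transpose_one, hA.eq]
  have hpos : (c • (1 : Matrix ι ι ℝ) - A).PosDef := by
    rw [hB.posDef_iff_eigenvalues_pos]
    intro i
    have h := hB.mulVec_eigenvectorBasis i
    rw [sub_mulVec, smul_mulVec, one_mulVec] at h
    have hlt := heig (c - hB.eigenvalues i) <| Module.End.hasEigenvalue_of_hasEigenvector
      (x := (hB.eigenvectorBasis i).ofLp) <| by
        rw [Module.End.hasEigenvector_iff, Module.End.mem_eigenspace_iff]
        refine ⟨?_, fun h0 => hB.eigenvectorBasis.orthonormal.ne_zero i ?_⟩
        · rw [toLin'_apply, sub_smul, ← h, sub_sub_cancel]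
        · ext j
          exact congrFun h0 j
    linarith
  have h := hpos.dotProduct_mulVec_pos hz
  rw [star_trivial, sub_mulVec, smul_mulVec, one_mulVec, dotProduct_sub, dotProduct_smul,
    smul_eq_mul] at h
  linarith

/-- Strict decrease: if all eigenvalues of the symmetric matrix `Δ` lie in
`[0, 2)` and the nonzero vector `x` is not an eigenvector of `Δ`, then the
Rayleigh quotient strictly decreases under the smoothing step:
`R((2I − Δ)x) < R(x)`. -/
theorem stmt5 {n : ℕ} (Δ : Matrix (Fin n) (Fin n) ℝ) (hΔ : Δ.IsSymm)
    (heig : ∀ μ : ℝ, Module.End.HasEigenvalue (Matrix.toLin' Δ) μ → μ ∈ Set.Ico (0 : ℝ) 2)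
    (R : (Fin n → ℝ) → ℝ)
    (hR : ∀ x : Fin n → ℝ, R x = (x ⬝ᵥ Δ.mulVec x) / (x ⬝ᵥ x))
    (x : Fin n → ℝ) (hx : x ≠ 0)
    (hnoteig : ¬ ∃ μ : ℝ, Δ.mulVec x = μ • x) :
    R ((((2 : ℝ) • (1 : Matrix (Fin n) (Fin n) ℝ) - Δ)).mulVec x) < R x := by
  have hlt {z : Fin n → ℝ} (hz : z ≠ 0) : z ⬝ᵥ Δ *ᵥ z < 2 * (z ⬝ᵥ z) :=
    hΔ.dotProduct_mulVec_lt (fun μ hμ => (heig μ hμ).2) hz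
  have hself {z : Fin n → ℝ} (hz : z ≠ 0) : 0 < z ⬝ᵥ z := by
    simpa using dotProduct_star_self_pos_iff.2 hz
  have hsymm (u w : Fin n → ℝ) : u ⬝ᵥ Δ *ᵥ w = w ⬝ᵥ Δ *ᵥ u := by
    rw [dotProduct_mulVec, ← mulVec_transpose, hΔ.eq, dotProduct_comm]
  obtain ⟨r, hr⟩ : ∃ r, R x = r := ⟨_, rfl⟩
  have hxx := hself hx
  have hrx : x ⬝ᵥ Δ *ᵥ x = r * (x ⬝ᵥ x) := by
    rw [← hr, hR, div_mul_cancel₀ _ hxx.ne']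
  have hr2 : r < 2 := lt_of_mul_lt_mul_right (hrx ▸ hlt hx) hxx.le
  -- The residual `v` is orthogonal to `x`, and the smoothing step sends `x` to `(2 - r) • x - v`.
  obtain ⟨v, hv⟩ : ∃ v, v = Δ *ᵥ x - r • x := ⟨_, rfl⟩
  have hΔx : Δ *ᵥ x = v + r • x := by rw [hv, sub_add_cancel]
  have hv0 : v ≠ 0 := fun h => hnoteig ⟨r, by rw [hΔx, h, zero_add]⟩
  have hxv : x ⬝ᵥ v = 0 := by
    rw [hv, dotProduct_sub, hrx, dotProduct_smul, smul_eq_mul, sub_self]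
  have hvx : v ⬝ᵥ x = 0 := by rw [dotProduct_comm, hxv]
  have hy : ((2 : ℝ) • (1 : Matrix (Fin n) (Fin n) ℝ) - Δ) *ᵥ x = (2 - r) • x - v := by
    rw [sub_mulVec, smul_mulVec, one_mulVec, hΔx]
    module
  have hy0 : (2 - r) • x - v ≠ 0 := fun h => hnoteig ⟨2, by
    rw [hΔx, ← sub_eq_zero.1 h]
    module⟩
  have hvΔx : v ⬝ᵥ Δ *ᵥ x = v ⬝ᵥ v := by
    rw [hΔx, dotProduct_add, dotProduct_smul, hvx, smul_zero, add_zero]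
  rw [hr, hR, hy, div_lt_iff₀ (hself hy0)]
  simp only [mulVec_sub, mulVec_smul, dotProduct_sub, sub_dotProduct, dotProduct_smul,
    smul_dotProduct, smul_eq_mul, hxv, hvx, hsymm x v, hvΔx, hrx]
  nlinarith [hlt hv0, mul_pos (sub_pos.2 hr2) (hself hv0)]
end

section
/- Let A be a symmetric n×n real matrix with nonnegative entries, let à = I + A be the self-loop-augmented adjacency matrix, let d̃_i = Σ_j Ã_{ij} (so d̃_i ≥ 1), let D̃ = diag(d̃₁,…,d̃_n), and let Δ̃ = I − D̃^{-1/2} à D̃^{-1/2}. Then for every nonzero x ∈ ℝⁿ, xᵀΔ̃x < 2·xᵀx; that is, every eigenvalue of the augmented normalized Laplacian Δ̃ is strictly less than 2. -/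
open Matrix

/-- The signless Laplacian `diag(A1) + A` of a symmetric nonnegative matrix is positive
semidefinite. -/
theorem signlessLaplacian_quadraticForm_nonneg {ι : Type*} [Fintype ι] {A : Matrix ι ι ℝ}
    (hA : A.IsSymm) (hnonneg : ∀ i j, 0 ≤ A i j) (y : ι → ℝ) :
    0 ≤ ∑ i, (∑ j, A i j) * y i ^ 2 + y ⬝ᵥ A *ᵥ y := by
  have hswap : ∑ i, ∑ j, A i j * y j ^ 2 = ∑ i, ∑ j, A i j * y i ^ 2 := by
    rw [Finset.sum_comm]
    simp_rw [hA.apply]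
  have hsq : 0 ≤ ∑ i, ∑ j, A i j * (y i + y j) ^ 2 :=
    Finset.sum_nonneg fun i _ => Finset.sum_nonneg fun j _ =>
      mul_nonneg (hnonneg i j) (sq_nonneg _)
  have hexpand : ∑ i, ∑ j, A i j * (y i + y j) ^ 2 =
      ∑ i, ∑ j, A i j * y i ^ 2 + ∑ i, ∑ j, A i j * y j ^ 2 +
        2 * ∑ i, ∑ j, y i * (A i j * y j) := by
    simp_rw [Finset.mul_sum, ← Finset.sum_add_distrib]
    exact Finset.sum_congr rfl fun i _ => Finset.sum_congr rfl fun j _ => by ring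
  have hform : y ⬝ᵥ A *ᵥ y = ∑ i, ∑ j, y i * (A i j * y j) := by
    simp only [dotProduct, mulVec_eq_sum, Finset.sum_apply, Pi.smul_apply, op_smul_eq_mul,
      transpose_apply, Finset.mul_sum]
  simp_rw [hform, Finset.sum_mul]
  linarith

/-- For the self-loop-augmented normalized Laplacian
`Δ̃ = I − D̃^{-1/2}(I + A)D̃^{-1/2}`, every nonzero `x` satisfies
`xᵀΔ̃x < 2·xᵀx`; i.e. every eigenvalue of `Δ̃` is strictly less than 2. -/
theorem stmt10 {n : ℕ} (A : Matrix (Fin n) (Fin n) ℝ) (hA : A.IsSymm)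
    (hnonneg : ∀ i j, 0 ≤ A i j)
    (Atil : Matrix (Fin n) (Fin n) ℝ) (hAtil : Atil = 1 + A)
    (dtil : Fin n → ℝ) (hdtil : ∀ i, dtil i = ∑ j, Atil i j)
    (Δtil : Matrix (Fin n) (Fin n) ℝ)
    (hΔtil : Δtil = 1 - Matrix.diagonal (fun i => (Real.sqrt (dtil i))⁻¹) * Atil *
      Matrix.diagonal (fun i => (Real.sqrt (dtil i))⁻¹)) :
    ∀ x : Fin n → ℝ, x ≠ 0 → x ⬝ᵥ Δtil.mulVec x < 2 * (x ⬝ᵥ x) := by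
  intro x hx
  have hd : ∀ i, dtil i = 1 + ∑ j, A i j := fun i => by
    simp [hdtil, hAtil, Finset.sum_add_distrib, Matrix.one_apply]
  have hdpos : ∀ i, 0 < dtil i := fun i => by
    rw [hd]
    linarith [Finset.sum_nonneg fun j (_ : j ∈ Finset.univ) => hnonneg i j]
  set S := Matrix.diagonal (fun i => (Real.sqrt (dtil i))⁻¹) with hS
  set y := S *ᵥ x with hy
  have hyi : ∀ i, y i = (Real.sqrt (dtil i))⁻¹ * x i := fun i => by
    rw [hy, hS, mulVec_diagonal]
  have hxx : x ⬝ᵥ x = y ⬝ᵥ y + ∑ i, (∑ j, A i j) * y i ^ 2 := by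
    simp only [dotProduct, ← Finset.sum_add_distrib]
    refine Finset.sum_congr rfl fun i _ => ?_
    have hne := (Real.sqrt_pos.2 (hdpos i)).ne'
    have hxi : x i = Real.sqrt (dtil i) * y i := by rw [hyi, mul_inv_cancel_left₀ hne]
    calc x i * x i = Real.sqrt (dtil i) ^ 2 * y i ^ 2 := by rw [hxi]; ring
      _ = y i * y i + (∑ j, A i j) * y i ^ 2 := by
        rw [Real.sq_sqrt (hdpos i).le, hd]; ring
  have hquad : x ⬝ᵥ Δtil *ᵥ x = x ⬝ᵥ x - (y ⬝ᵥ y + y ⬝ᵥ A *ᵥ y) := by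
    have hvec : x ᵥ* S = y := by
      rw [← mulVec_transpose, hS, diagonal_transpose]
    rw [hΔtil, sub_mulVec, one_mulVec, dotProduct_sub, ← mulVec_mulVec, ← mulVec_mulVec,
      dotProduct_mulVec x S, hvec, ← hy, hAtil, add_mulVec, one_mulVec, dotProduct_add]
  have hy0 : y ≠ 0 := fun h => hx <| funext fun i => by
    have h0 := hyi i
    rw [h, Pi.zero_apply, zero_eq_mul] at h0
    exact h0.resolve_left (inv_ne_zero (Real.sqrt_pos.2 (hdpos i)).ne')
  have hypos : 0 < y ⬝ᵥ y :=
    lt_of_le_of_ne (Finset.sum_nonneg fun i _ => mul_self_nonneg (y i))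
      fun h => hy0 (dotProduct_self_eq_zero.1 h.symm)
  linarith [signlessLaplacian_quadraticForm_nonneg hA hnonneg y]
end

section
/- Let A be a real symmetric n×n matrix with nonnegative eigenvalues, with orthonormal eigenvectors u₁, u₂, …, u_n and corresponding eigenvalues λ₁ ≥ λ₂ ≥ … ≥ λ_n ≥ 0. Assume λ₂ > 0 and λ₂ > λ_i for all i ≥ 3, and let P = I − u₁u₁ᵀ be the orthogonal projection onto the orthogonal complement of u₁. Then P commutes with A, and for every x ∈ ℝⁿ with ⟨x, u₂⟩ ≠ 0, the deflated power iteration satisfies (P·A)ᵏ x / λ₂ᵏ → ⟨x, u₂⟩ · u₂ as k → ∞; that is, interleaving the projection P with repeated application of A converges in direction to the second eigenvector u₂. -/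
open Matrix

theorem Orthonormal.sum_dotProduct_smul_ofLp {n : ℕ} {u : Fin n → EuclideanSpace ℝ (Fin n)}
    (hu : Orthonormal ℝ u) (x : Fin n → ℝ) :
    ∑ i, (x ⬝ᵥ (u i : Fin n → ℝ)) • (u i : Fin n → ℝ) = x := by
  have hspan : ⊤ ≤ Submodule.span ℝ (Set.range u) :=
    (hu.linearIndependent.span_eq_top_of_card_eq_finrank' (by simp)).ge
  have h := (OrthonormalBasis.mk hu hspan).sum_repr' (WithLp.toLp 2 x)
  simp only [OrthonormalBasis.coe_mk] at h
  simpa [EuclideanSpace.inner_eq_star_dotProduct] using congrArg WithLp.ofLp h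

theorem Orthonormal.dotProduct_ofLp {ι m : Type*} [DecidableEq ι] [Fintype m]
    {u : ι → EuclideanSpace ℝ m} (hu : Orthonormal ℝ u) (i j : ι) :
    (u i : m → ℝ) ⬝ᵥ (u j : m → ℝ) = if j = i then 1 else 0 := by
  simpa [EuclideanSpace.inner_eq_star_dotProduct] using orthonormal_iff_ite.mp hu j i

theorem Matrix.pow_mulVec_of_mulVec_eq_smul {m R : Type*} [Fintype m] [DecidableEq m]
    [CommSemiring R] {M : Matrix m m R} {v : m → R} {μ : R} (h : M *ᵥ v = μ • v) (k : ℕ) :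
    (M ^ k) *ᵥ v = μ ^ k • v := by
  induction k with
  | zero => simp
  | succ k ih => rw [pow_succ, ← mulVec_mulVec, h, mulVec_smul, ih, smul_smul, pow_succ']

/-- The power iteration of a matrix with an orthonormal eigenbasis, scaled by a strictly dominant
eigenvalue, converges to the component along the corresponding eigenvector. -/
theorem Matrix.tendsto_inv_pow_smul_pow_mulVec {n : ℕ} {M : Matrix (Fin n) (Fin n) ℝ}
    {u : Fin n → EuclideanSpace ℝ (Fin n)} (hu : Orthonormal ℝ u) {μ : Fin n → ℝ}
    (h : ∀ i, M *ᵥ (u i : Fin n → ℝ) = μ i • (u i : Fin n → ℝ)) {j : Fin n} (hj : 0 < μ j)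
    (hdom : ∀ i, i ≠ j → |μ i| < μ j) (x : Fin n → ℝ) :
    Filter.Tendsto (fun k : ℕ => (μ j ^ k)⁻¹ • (M ^ k) *ᵥ x) Filter.atTop
      (nhds ((x ⬝ᵥ (u j : Fin n → ℝ)) • (u j : Fin n → ℝ))) := by
  have hexp (k : ℕ) : (μ j ^ k)⁻¹ • (M ^ k) *ᵥ x =
      ∑ i, (μ i / μ j) ^ k • (x ⬝ᵥ (u i : Fin n → ℝ)) • (u i : Fin n → ℝ) := by
    conv_lhs => rw [← hu.sum_dotProduct_smul_ofLp x]
    rw [mulVec_sum, Finset.smul_sum]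
    refine Finset.sum_congr rfl fun i _ => ?_
    rw [mulVec_smul, pow_mulVec_of_mulVec_eq_smul (h i), smul_smul, smul_smul, smul_smul, div_pow]
    congr 1
    ring
  have hlim : (x ⬝ᵥ (u j : Fin n → ℝ)) • (u j : Fin n → ℝ) =
      ∑ i, (if i = j then (1 : ℝ) else 0) • (x ⬝ᵥ (u i : Fin n → ℝ)) • (u i : Fin n → ℝ) := by
    simp [ite_smul]
  rw [funext hexp, hlim]
  refine tendsto_finsetSum _ fun i _ => Filter.Tendsto.smul_const ?_ _
  split_ifs with hij
  · subst hij
    exact tendsto_const_nhds.congr fun k => by rw [div_self hj.ne', one_pow]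
  · refine tendsto_pow_atTop_nhds_zero_of_abs_lt_one ?_
    rw [abs_div, abs_of_pos hj, div_lt_one hj]
    exact hdom i hij

/-- Deflated power iteration (mean-subtraction approximates the Fiedler vector):
if `A` is symmetric with orthonormal eigenvectors `u 0, u 1, …` and decreasing
nonnegative eigenvalues `lam 0 ≥ lam 1 ≥ …`, with `lam 1 > 0` and
`lam 1 > lam i` for `i ≥ 2`, and `P = I − u₁u₁ᵀ` is the projection away from the
top eigenvector, then `P` commutes with `A` and for every `x` with
`⟨x, u 1⟩ ≠ 0`, `(P·A)ᵏ x / (lam 1)ᵏ → ⟨x, u 1⟩ • u 1`. -/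
theorem stmt15 {n : ℕ} (hn : 2 ≤ n) (A : Matrix (Fin n) (Fin n) ℝ) (hA : A.IsSymm)
    (u : Fin n → EuclideanSpace ℝ (Fin n)) (hortho : Orthonormal ℝ u)
    (lam : Fin n → ℝ)
    (heig : ∀ i, A.mulVec (u i) = lam i • (u i : Fin n → ℝ))
    (hdec : ∀ i j : Fin n, i ≤ j → lam j ≤ lam i)
    (hnonneg : ∀ i, 0 ≤ lam i)
    (hl2pos : 0 < lam ⟨1, by omega⟩)
    (hgap : ∀ i : Fin n, 2 ≤ (i : ℕ) → lam i < lam ⟨1, by omega⟩)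
    (P : Matrix (Fin n) (Fin n) ℝ)
    (hP : P = 1 - Matrix.vecMulVec (u ⟨0, by omega⟩) (u ⟨0, by omega⟩)) :
    P * A = A * P ∧
      ∀ x : Fin n → ℝ, x ⬝ᵥ (u ⟨1, by omega⟩ : Fin n → ℝ) ≠ 0 →
        Filter.Tendsto (fun k : ℕ => (lam ⟨1, by omega⟩ ^ k)⁻¹ • ((P * A) ^ k).mulVec x)
          Filter.atTop
          (nhds ((x ⬝ᵥ (u ⟨1, by omega⟩ : Fin n → ℝ)) • (u ⟨1, by omega⟩ : Fin n → ℝ))) := by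
  have h0 : (u ⟨0, by omega⟩ : Fin n → ℝ) ᵥ* A =
      lam ⟨0, by omega⟩ • (u ⟨0, by omega⟩ : Fin n → ℝ) := by
    rw [← mulVec_transpose, hA.eq, heig]
  refine ⟨?_, fun x _ => ?_⟩
  · rw [hP, sub_mul, mul_sub, one_mul, mul_one, vecMulVec_mul, mul_vecMulVec, h0, heig,
      smul_vecMulVec, vecMulVec_smul]
  · let μ : Fin n → ℝ := fun i => if i = ⟨0, by omega⟩ then 0 else lam i
    have hμ1 : μ ⟨1, by omega⟩ = lam ⟨1, by omega⟩ := by simp [μ]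
    have hμ (i : Fin n) : (P * A) *ᵥ (u i : Fin n → ℝ) = μ i • (u i : Fin n → ℝ) := by
      rw [← mulVec_mulVec, heig, mulVec_smul, hP, sub_mulVec, one_mulVec, vecMulVec_mulVec,
        hortho.dotProduct_ofLp]
      by_cases hi : i = ⟨0, by omega⟩
      · simp [μ, hi]
      · simp [μ, hi]
    rw [← hμ1]
    refine tendsto_inv_pow_smul_pow_mulVec hortho hμ (hμ1 ▸ hl2pos) (fun i hi => ?_) x
    rw [hμ1]
    by_cases hi0 : i = ⟨0, by omega⟩
    · simpa [μ, hi0] using hl2pos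
    · have hi2 : 2 ≤ (i : ℕ) := by
        rw [Ne, Fin.ext_iff] at hi
        rw [Fin.ext_iff] at hi0
        simp only at hi hi0
        omega
      simpa [μ, hi0, abs_of_nonneg (hnonneg i)] using hgap i hi2
end
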